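/- For a real number a > 0 and an integer p ≥ 1, define u_p : ℝ² → ℝ by u_p(r,z) = exp(1/(p²((r−a)²+z²) − 1)) if (r−a)²+z² < 1/p², and u_p(r,z) = 0 otherwise; u_p is C¹, bounded by 1, and u_p(a,0) = 1/e. Then lim_{p→∞} ∫_{a−1/p}^{a} r·(∂u_p/∂r)(r,0) dr = a/e. -/

import Mathlib

open Filter

/-- The bump deformation `u_p(r,z) = exp(1/(p²((r−a)²+z²) − 1))` on the open ball of
center `(a,0)` and radius `1/p`, extended by `0`. -/
noncomputable def up (a : ℝ) (p : ℕ) : ℝ × ℝ → ℝ := fun x =>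
  if (x.1 - a) ^ 2 + x.2 ^ 2 < 1 / (p : ℝ) ^ 2 then
    Real.exp (1 / ((p : ℝ) ^ 2 * ((x.1 - a) ^ 2 + x.2 ^ 2) - 1))
  else 0

theorem up_eq_expNegInvGlue (a : ℝ) {p : ℕ} (hp : 0 < p) :
    up a p = fun x => expNegInvGlue (1 - (p : ℝ) ^ 2 * ((x.1 - a) ^ 2 + x.2 ^ 2)) := by
  have hp2 : (0 : ℝ) < (p : ℝ) ^ 2 := by positivity
  funext x
  have hiff : (x.1 - a) ^ 2 + x.2 ^ 2 < 1 / (p : ℝ) ^ 2 ↔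
      ¬ 1 - (p : ℝ) ^ 2 * ((x.1 - a) ^ 2 + x.2 ^ 2) ≤ 0 := by
    rw [lt_div_iff₀ hp2, not_le, sub_pos, mul_comm]
  simp only [up, expNegInvGlue, hiff, ite_not]
  split_ifs
  · rfl
  · rw [← inv_neg, neg_sub, one_div]

theorem contDiff_up (a : ℝ) {p : ℕ} (hp : 0 < p) : ContDiff ℝ 1 (up a p) := by
  rw [up_eq_expNegInvGlue a hp]
  exact (expNegInvGlue.contDiff (n := 1)).comp (by fun_prop)

theorem abs_up_le_one (a : ℝ) (p : ℕ) (x : ℝ × ℝ) : |up a p x| ≤ 1 := by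
  rcases p.eq_zero_or_pos with rfl | hp
  · have h : ¬ (x.1 - a) ^ 2 + x.2 ^ 2 < 0 := by
      rw [not_lt]
      positivity
    simp [up, h]
  · rw [up_eq_expNegInvGlue a hp, abs_of_nonneg (expNegInvGlue.nonneg _), expNegInvGlue]
    split_ifs with h
    · exact zero_le_one
    · rw [Real.exp_le_one_iff, neg_nonpos, inv_nonneg]
      exact (not_le.1 h).le

theorem up_center (a : ℝ) {p : ℕ} (hp : 0 < p) : up a p (a, 0) = (Real.exp 1)⁻¹ := by
  simp [up, hp, Real.exp_neg]

theorem up_left_endpoint (a : ℝ) (p : ℕ) : up a p (a - 1 / (p : ℝ), 0) = 0 := by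
  simp [up]

theorem integral_mul_fderiv_up (a : ℝ) {p : ℕ} (hp : 0 < p) :
    ∫ r in (a - 1 / (p : ℝ))..a, r * fderiv ℝ (up a p) (r, 0) (1, 0) =
      a / Real.exp 1 - ∫ r in (a - 1 / (p : ℝ))..a, up a p (r, 0) := by
  have hderiv (r : ℝ) : HasDerivAt (fun r => up a p (r, 0))
      (fderiv ℝ (up a p) (r, 0) (1, 0)) r :=
    (((contDiff_up a hp).differentiable one_ne_zero) (r, 0)).hasFDerivAt.comp_hasDerivAt_of_eq r
      ((hasDerivAt_id' r).prodMk (hasDerivAt_const r (0 : ℝ))) rfl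
  have hcont : Continuous fun r : ℝ => fderiv ℝ (up a p) (r, 0) (1, 0) :=
    (((contDiff_up a hp).continuous_fderiv one_ne_zero).comp (by fun_prop)).clm_apply
      continuous_const
  rw [intervalIntegral.integral_mul_deriv_eq_deriv_mul (fun r _ => hasDerivAt_id' r)
    (fun r _ => hderiv r) intervalIntegrable_const (hcont.intervalIntegrable _ _)]
  rw [up_center a hp, up_left_endpoint, mul_zero, sub_zero, ← div_eq_mul_inv a]
  simp only [one_mul]

theorem abs_integral_up_le (a : ℝ) (p : ℕ) :
    |∫ r in (a - 1 / (p : ℝ))..a, up a p (r, 0)| ≤ 1 / (p : ℝ) := by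
  simpa using intervalIntegral.norm_integral_le_of_norm_le_const
    (a := a - 1 / (p : ℝ)) (b := a) (f := fun r => up a p (r, 0)) (C := 1)
    fun r _ => abs_up_le_one a p (r, 0)

/-- Limit (ls_2): `∫_{a−1/p}^{a} r·∂u_p/∂r(r,0) dr → a/e` as `p → ∞`. -/
theorem stmt_13 (a : ℝ) (ha : 0 < a) :
    Tendsto (fun p : ℕ => ∫ r in (a - 1 / (p : ℝ))..a, r * fderiv ℝ (up a p) (r, 0) (1, 0))
      atTop (nhds (a / Real.exp 1)) := by
  have hzero : Tendsto (fun p : ℕ => ∫ r in (a - 1 / (p : ℝ))..a, up a p (r, 0))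
      atTop (nhds 0) :=
    squeeze_zero_norm (abs_integral_up_le a) tendsto_one_div_atTop_nhds_zero_nat
  refine Tendsto.congr' ?_ (sub_zero (a / Real.exp 1) ▸ hzero.const_sub (a / Real.exp 1))
  filter_upwards [eventually_gt_atTop 0] with p hp
  exact (integral_mul_fderiv_up a hp).symm
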